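/- Attainment of the coarse-grained distance by a simple path: in a finite directed graph with natural-number edge activation levels, if there exists a walk from u to v, then there exists a simple path (a walk with no repeated vertices) from u to v whose coarse-grained score equals D(u, v); in particular D(u, v) < ∞ and the minimum defining D(u, v) is attained. -/

import Mathlib

/-- A walk in the directed graph with adjacency relation `Adj`, represented by
its (nonempty) list of vertices, consecutive vertices being joined by a
directed edge. Vertices may repeat. -/
def IsWalk {V : Type*} (Adj : V → V → Prop) (p : List V) : Prop :=
  p ≠ [] ∧ p.Chain' Adj

/-- The coarse-grained score `F(p)` of a walk `p` over a graph whose edges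
carry natural-number activation levels `lvl`: `F` of a single-vertex walk
is `0`, and appending an edge with level `a` to a walk of score `s` gives
score `max s a + 1` (the fold processes the consecutive edges of `p`
in path order). -/
def wscore {V : Type*} (lvl : V → V → ℕ) (p : List V) : ℕ :=
  ((p.zip p.tail).map (fun e => lvl e.1 e.2)).foldl (fun s a => max s a + 1) 0

/-- The coarse-grained distance `D(u, v)`: the minimum of `F(p)` over all
walks `p` from `u` to `v`, and `∞` if there is no such walk. -/
noncomputable def wdist {V : Type*} (Adj : V → V → Prop) (lvl : V → V → ℕ)
    (u v : V) : ℕ∞ :=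
  sInf {n : ℕ∞ | ∃ p : List V, IsWalk Adj p ∧ p.head? = some u ∧
    p.getLast? = some v ∧ (wscore lvl p : ℕ∞) = n}

theorem zip_tail_append_pair {V : Type*} (p : List V) (y x : V) :
    (p ++ [y, x]).zip (p ++ [y, x]).tail = (p ++ [y]).zip (p ++ [y]).tail ++ [(y, x)] := by
  induction p with
  | nil => rfl
  | cons c p ih =>
    cases p with
    | nil => rfl
    | cons d p => simpa using ih

theorem wscore_append_pair {V : Type*} (lvl : V → V → ℕ) (p : List V) (y x : V) :
    wscore lvl (p ++ [y, x]) = max (wscore lvl (p ++ [y])) (lvl y x) + 1 := by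
  simp only [wscore, zip_tail_append_pair, List.map_append, List.foldl_append, List.map_cons,
    List.map_nil, List.foldl_cons, List.foldl_nil]

theorem wscore_le_append {V : Type*} (lvl : V → V → ℕ) (p q : List V) :
    wscore lvl p ≤ wscore lvl (p ++ q) := by
  induction q using List.reverseRecOn with
  | nil => simp
  | append_singleton q z ih =>
    refine ih.trans ?_
    rw [← List.append_assoc]
    rcases List.eq_nil_or_concat' (p ++ q) with h | ⟨r, y, h⟩
    · simp [h, wscore]
    · rw [h, List.append_assoc]
      have := wscore_append_pair lvl r y z
      simp only [List.cons_append, List.nil_append]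
      omega

/-- Every walk can be replaced by a simple path with the same endpoints and no larger score. -/
theorem IsWalk.exists_nodup_wscore_le {V : Type*} {Adj : V → V → Prop} (lvl : V → V → ℕ)
    {u v : V} {p : List V} (hp : IsWalk Adj p) (hu : p.head? = some u)
    (hv : p.getLast? = some v) :
    ∃ q : List V, IsWalk Adj q ∧ q.head? = some u ∧ q.getLast? = some v ∧ q.Nodup ∧
      wscore lvl q ≤ wscore lvl p := by
  induction p using List.reverseRecOn generalizing v with
  | nil => simp at hu
  | append_singleton p x ih =>
    obtain rfl : x = v := by simpa using hv
    rcases List.eq_nil_or_concat' p with rfl | ⟨r, y, rfl⟩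
    · exact ⟨[x], hp, hu, hv, List.nodup_singleton x, le_rfl⟩
    have hc := List.isChain_append.1 hp.2
    have hadj : Adj y x := hc.2.2 y (by simp) x (by simp)
    obtain ⟨q, hq, hqu, hqv, hnd, hle⟩ :=
      ih ⟨by simp, hc.1⟩ (by cases r <;> simpa using hu) (v := y) (by simp)
    have hscore : wscore lvl (r ++ [y] ++ [x]) = max (wscore lvl (r ++ [y])) (lvl y x) + 1 := by
      simpa using wscore_append_pair lvl r y x
    by_cases hx : x ∈ q
    · obtain ⟨a, b, rfl⟩ := List.append_of_mem hx
      have hsplit : a ++ x :: b = (a ++ [x]) ++ b := by simp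
      rw [hsplit] at hq hqu hnd hle
      refine ⟨a ++ [x], ⟨by simp, (List.isChain_append.1 hq.2).1⟩,
        by cases a <;> simpa using hqu, by simp, (List.nodup_append.1 hnd).1, ?_⟩
      have := wscore_le_append lvl (a ++ [x]) b
      omega
    · obtain ⟨s, rfl⟩ : ∃ s, q = s ++ [y] :=
        List.getLast?_eq_some_iff.1 hqv
      refine ⟨s ++ [y] ++ [x], ⟨by simp, List.isChain_append.2 ⟨hq.2, by simp, ?_⟩⟩,
        by cases s <;> simpa using hqu, by simp, ?_, ?_⟩
      · simpa using hadj
      · exact hnd.append (List.nodup_singleton x) (by simpa using hx)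
      · have : wscore lvl (s ++ [y] ++ [x]) = max (wscore lvl (s ++ [y])) (lvl y x) + 1 := by
          simpa using wscore_append_pair lvl s y x
        omega

/-- Attainment of the coarse-grained distance by a simple path: in a finite
directed graph with natural-number edge activation levels, if there exists a
walk from `u` to `v`, then there exists a simple path (a walk with no repeated
vertices) from `u` to `v` whose score equals `D(u, v)`; in particular
`D(u, v) < ∞` and the minimum defining `D(u, v)` is attained. -/
theorem stmt14 {V : Type*} [Fintype V] (Adj : V → V → Prop) (lvl : V → V → ℕ)
    (u v : V)
    (h : ∃ p : List V, IsWalk Adj p ∧ p.head? = some u ∧ p.getLast? = some v) :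
    ∃ p : List V, IsWalk Adj p ∧ p.head? = some u ∧ p.getLast? = some v ∧
      p.Nodup ∧ (wscore lvl p : ℕ∞) = wdist Adj lvl u v ∧
      wdist Adj lvl u v < ⊤ := by
  have hne : {n : ℕ∞ | ∃ p : List V, IsWalk Adj p ∧ p.head? = some u ∧
      p.getLast? = some v ∧ (wscore lvl p : ℕ∞) = n}.Nonempty := by
    obtain ⟨p, hp, hu, hv⟩ := h
    exact ⟨_, p, hp, hu, hv, rfl⟩
  obtain ⟨p, hp, hu, hv, hscore⟩ := csInf_mem hne
  obtain ⟨q, hq, hqu, hqv, hnd, hle⟩ := hp.exists_nodup_wscore_le lvl hu hv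
  have heq : (wscore lvl q : ℕ∞) = wdist Adj lvl u v := by
    refine le_antisymm ?_ (sInf_le ⟨q, hq, hqu, hqv, rfl⟩)
    exact (Nat.cast_le.2 hle).trans hscore.le
  exact ⟨q, hq, hqu, hqv, hnd, heq, heq ▸ ENat.natCast_lt_top _⟩
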